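/- arXiv:2508.16928 — 2 statements merged into one kernel-verified Lean document; each statement's English description precedes it below -/
import Mathlib

section
/- For every real number c < π²/2 there exists a minimal graph f : 𝔻 → ℝ over the open unit disk whose gradient vanishes at the origin (f_u(0,0) = f_v(0,0) = 0) and whose Gaussian curvature at the origin satisfies |K(0,0)| > c. -/
open Real

/-- The open unit disk in `ℝ × ℝ`. -/
def unitDisk : Set (ℝ × ℝ) := {p : ℝ × ℝ | p.1 ^ 2 + p.2 ^ 2 < 1}

/-- Partial derivative with respect to the first coordinate `u`. -/
noncomputable def pu (f : ℝ × ℝ → ℝ) (p : ℝ × ℝ) : ℝ :=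
  deriv (fun u : ℝ => f (u, p.2)) p.1

/-- Partial derivative with respect to the second coordinate `v`. -/
noncomputable def pv (f : ℝ × ℝ → ℝ) (p : ℝ × ℝ) : ℝ :=
  deriv (fun v : ℝ => f (p.1, v)) p.2

/-- `f : 𝔻 → ℝ` is a minimal graph over the open unit disk: it is `C²` there and
    satisfies the minimal surface equation. -/
def IsMinimalGraph (f : ℝ × ℝ → ℝ) : Prop :=
  ContDiffOn ℝ 2 f unitDisk ∧
    ∀ p ∈ unitDisk,
      (1 + (pv f p) ^ 2) * pu (pu f) p
        - 2 * pu f p * pv f p * pv (pu f) p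
        + (1 + (pu f p) ^ 2) * pv (pv f) p = 0

section

open Complex Metric Topology ComplexConjugate

/-- Weierstrass data on the unit disk: `h + conj g` is a planar harmonic map with dilatation `q ^ 2`,
and `2 * re k` is the height of the minimal surface above it. -/
structure IsWeierstrassData (h g k η q : ℂ → ℂ) : Prop where
  hasDerivAt_h : ∀ z ∈ ball (0 : ℂ) 1, HasDerivAt h (η z) z
  hasDerivAt_g : ∀ z ∈ ball (0 : ℂ) 1, HasDerivAt g (q z ^ 2 * η z) z
  hasDerivAt_k : ∀ z ∈ ball (0 : ℂ) 1, HasDerivAt k (I * q z * η z) z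
  ne_zero : ∀ z ∈ ball (0 : ℂ) 1, η z ≠ 0
  differentiableOn_q : DifferentiableOn ℂ q (ball 0 1)
  norm_q_lt : ∀ z ∈ ball (0 : ℂ) 1, ‖q z‖ < 1

/-- The `ℝ`-linear map `v ↦ A v + conj (B v)` is invertible when `‖B‖ < ‖A‖`. -/
lemma exists_equiv_of_norm_lt {A B : ℂ} (hAB : ‖B‖ < ‖A‖) :
    ∃ L : ℂ ≃L[ℝ] ℂ, ∀ v, L v = A * v + conj (B * v) := by
  let L₀ : ℂ →ₗ[ℝ] ℂ :=
    { toFun := fun v => A * v + conj (B * v)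
      map_add' := fun v w => by simp only [mul_add, map_add]; ring
      map_smul' := fun c v => by
        simp only [real_smul, map_mul, conj_ofReal, RingHom.id_apply]; ring }
  have hinj : Function.Injective L₀ := by
    rw [← LinearMap.ker_eq_bot, LinearMap.ker_eq_bot']
    intro v hv
    have h1 : A * v = - conj (B * v) := eq_neg_of_add_eq_zero_left hv
    have h2 : ‖A‖ * ‖v‖ = ‖B‖ * ‖v‖ := by
      simpa using congrArg norm h1
    by_contra hne
    exact hAB.ne' (mul_right_cancel₀ (norm_ne_zero_iff.2 hne) h2)
  exact ⟨(LinearEquiv.ofInjectiveEndo L₀ hinj).toContinuousLinearEquiv, fun v => rfl⟩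

lemma contDiffAt_real_of_differentiableOn_ball {f : ℂ → ℂ} (hf : DifferentiableOn ℂ f (ball 0 1))
    {z : ℂ} (hz : z ∈ ball (0 : ℂ) 1) : ContDiffAt ℝ 2 f z :=
  ((hf.contDiffOn isOpen_ball).contDiffAt (isOpen_ball.mem_nhds hz)).restrict_scalars ℝ

namespace IsWeierstrassData

variable {h g k η q : ℂ → ℂ}

lemma contDiffAt (W : IsWeierstrassData h g k η q)
    {z : ℂ} (hz : z ∈ ball (0 : ℂ) 1) :
    ContDiffAt ℝ 2 (fun z => h z + conj (g z)) z := by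
  have h1 := contDiffAt_real_of_differentiableOn_ball
    (fun z hz => (W.hasDerivAt_h z hz).differentiableAt.differentiableWithinAt) hz
  have h2 := contDiffAt_real_of_differentiableOn_ball
    (fun z hz => (W.hasDerivAt_g z hz).differentiableAt.differentiableWithinAt) hz
  exact h1.add (conjCLE.contDiff.contDiffAt.comp z h2)

lemma exists_hasFDerivAt (W : IsWeierstrassData h g k η q)
    {z : ℂ} (hz : z ∈ ball (0 : ℂ) 1) :
    ∃ L : ℂ ≃L[ℝ] ℂ, (∀ v, L v = η z * v + conj (q z ^ 2 * η z * v)) ∧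
      HasFDerivAt (fun z => h z + conj (g z)) (L : ℂ →L[ℝ] ℂ) z := by
  have hq := W.norm_q_lt z hz
  have hη : 0 < ‖η z‖ := norm_pos_iff.2 (W.ne_zero z hz)
  obtain ⟨L, hL⟩ := exists_equiv_of_norm_lt (A := η z) (B := q z ^ 2 * η z) (by
    rw [norm_mul, norm_pow]
    nlinarith [norm_nonneg (q z), mul_pos hη (by nlinarith [norm_nonneg (q z)] :
      (0 : ℝ) < 1 - ‖q z‖ ^ 2)])
  refine ⟨L, hL, ?_⟩
  have h1 := ((W.hasDerivAt_h z hz).hasFDerivAt.restrictScalars ℝ).add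
    (conjCLE.hasFDerivAt.comp z ((W.hasDerivAt_g z hz).hasFDerivAt.restrictScalars ℝ))
  refine h1.congr_fderiv ?_
  ext v
  simp [hL, mul_comm]

/-- Near every point of the disk the harmonic map is a local diffeomorphism. -/
lemma exists_openPartialHomeomorph (W : IsWeierstrassData h g k η q)
    {z : ℂ} (hz : z ∈ ball (0 : ℂ) 1) :
    ∃ φ : OpenPartialHomeomorph ℂ ℂ, z ∈ φ.source ∧ ⇑φ = (fun z => h z + conj (g z)) ∧
      ContDiffAt ℝ 2 φ.symm (h z + conj (g z)) := by
  obtain ⟨L, -, hL⟩ := W.exists_hasFDerivAt hz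
  refine ⟨(W.contDiffAt hz).toOpenPartialHomeomorph _ hL two_ne_zero,
    (W.contDiffAt hz).mem_toOpenPartialHomeomorph_source hL two_ne_zero, rfl, ?_⟩
  exact (W.contDiffAt hz).to_localInverse hL two_ne_zero

/-- A continuous section of the harmonic map is `C²`. -/
lemma contDiffAt_section (W : IsWeierstrassData h g k η q)
    {S : ℂ → ℂ} {w : ℂ} (hS : ContinuousAt S w) (hw : S w ∈ ball (0 : ℂ) 1)
    (hFS : ∀ᶠ y in 𝓝 w, h (S y) + conj (g (S y)) = y) : ContDiffAt ℝ 2 S w := by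
  obtain ⟨φ, hφ, hφF, hφs⟩ := W.exists_openPartialHomeomorph hw
  rw [hFS.self_of_nhds] at hφs
  refine hφs.congr_of_eventuallyEq ?_
  filter_upwards [hFS, hS.eventually (φ.open_source.mem_nhds hφ)] with y hy hy'
  conv_rhs => rw [← hy]
  have := φ.left_inv hy'
  rw [hφF] at this
  exact this.symm

/-- The derivative of a continuous section along curves. -/
lemma hasDerivAt_section_comp (W : IsWeierstrassData h g k η q)
    {S : ℂ → ℂ} {w : ℂ} (hS : ContinuousAt S w)
    (hw : S w ∈ ball (0 : ℂ) 1) (hFS : ∀ᶠ y in 𝓝 w, h (S y) + conj (g (S y)) = y)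
    {γ : ℝ → ℂ} {t : ℝ} {e : ℂ} (hγ : HasDerivAt γ e t) (hγw : γ t = w) :
    HasDerivAt (fun τ => S (γ τ))
      ((e - conj (q (S w)) ^ 2 * conj e) / (1 - ‖q (S w)‖ ^ 4 : ℝ) / η (S w)) t := by
  have hSd : HasFDerivAt S (fderiv ℝ S w) w :=
    ((W.contDiffAt_section hS hw hFS).differentiableAt two_ne_zero).hasFDerivAt
  subst hγw
  have h1 : HasDerivAt (fun τ => S (γ τ)) (fderiv ℝ S (γ t) e) t :=
    hSd.comp_hasDerivAt t hγ
  obtain ⟨L, hL, hLF⟩ := W.exists_hasFDerivAt hw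
  have h2 := hLF.comp_hasDerivAt t h1
  have h3 : HasDerivAt γ (L (fderiv ℝ S (γ t) e)) t :=
    h2.congr_of_eventuallyEq ((hγ.continuousAt.eventually hFS).mono fun τ hτ => hτ.symm)
  have h4 := h3.unique hγ
  rw [hL] at h4
  convert h1 using 1
  have hη := W.ne_zero _ hw
  have hq := W.norm_q_lt _ hw
  generalize fderiv ℝ S (γ t) e = a at *
  generalize S (γ t) = z at *
  have hq4 : (1 : ℝ) - ‖q z‖ ^ 4 ≠ 0 := by
    have : ‖q z‖ ^ 4 < 1 := pow_lt_one₀ (norm_nonneg _) hq (by norm_num)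
    linarith
  have hq4' : ((1 - ‖q z‖ ^ 4 : ℝ) : ℂ) ≠ 0 := by exact_mod_cast hq4
  have hn : ((1 - ‖q z‖ ^ 4 : ℝ) : ℂ) = 1 - (q z) ^ 2 * conj (q z) ^ 2 := by
    push_cast
    rw [← mul_pow, mul_conj, normSq_eq_norm_sq]; push_cast; ring
  rw [div_div, div_eq_iff (mul_ne_zero hq4' hη), hn, ← h4]
  simp only [map_add, map_mul, map_pow, conj_conj]
  ring

end IsWeierstrassData

/-- The height function of the minimal surface, as a graph over the plane via the section `S`. -/
noncomputable def heightGraph (k S : ℂ → ℂ) (p : ℝ × ℝ) : ℝ :=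
  2 * (k (S (p.1 + p.2 * I))).re

lemma toComplex_mem_ball {p : ℝ × ℝ} : (p.1 + p.2 * I : ℂ) ∈ ball (0 : ℂ) 1 ↔ p ∈ unitDisk := by
  rw [mem_ball_zero_iff, ← sq_lt_one_iff₀ (norm_nonneg _), ← normSq_eq_norm_sq, normSq_add_mul_I]
  rfl

lemma isOpen_unitDisk : IsOpen unitDisk :=
  isOpen_lt (by fun_prop) continuous_const

lemma hasDerivAt_horizontal (p : ℝ × ℝ) :
    HasDerivAt (fun u : ℝ => (u + p.2 * I : ℂ)) 1 p.1 :=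
  (hasDerivAt_id p.1).ofReal_comp.add_const _

lemma hasDerivAt_vertical (p : ℝ × ℝ) :
    HasDerivAt (fun v : ℝ => (p.1 + v * I : ℂ)) I p.2 := by
  simpa using ((hasDerivAt_id p.2).ofReal_comp.mul_const I).const_add (p.1 : ℂ)

lemma eventually_horizontal_mem {p : ℝ × ℝ} (hp : p ∈ unitDisk) :
    ∀ᶠ u in 𝓝 p.1, (u, p.2) ∈ unitDisk :=
  (by fun_prop : Continuous fun u : ℝ => (u, p.2)).continuousAt.eventually
    (isOpen_unitDisk.mem_nhds hp)

lemma eventually_vertical_mem {p : ℝ × ℝ} (hp : p ∈ unitDisk) :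
    ∀ᶠ v in 𝓝 p.2, (p.1, v) ∈ unitDisk :=
  (by fun_prop : Continuous fun v : ℝ => (p.1, v)).continuousAt.eventually
    (isOpen_unitDisk.mem_nhds hp)

lemma hasDerivAt_im_div {Q : ℝ → ℂ} {D : ℂ} {t : ℝ} (hQ : HasDerivAt Q D t) (hQt : ‖Q t‖ < 1) :
    HasDerivAt (fun τ => -2 * (Q τ).im / (1 - (Q τ).re ^ 2 - (Q τ).im ^ 2))
      (-2 * (D.im * (1 - (Q t).re ^ 2 - (Q t).im ^ 2)
        + 2 * (Q t).im * ((Q t).re * D.re + (Q t).im * D.im))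
        / (1 - (Q t).re ^ 2 - (Q t).im ^ 2) ^ 2) t := by
  have hre : HasDerivAt (fun τ => (Q τ).re) D.re t := reCLM.hasFDerivAt.comp_hasDerivAt t hQ
  have him : HasDerivAt (fun τ => (Q τ).im) D.im t := imCLM.hasFDerivAt.comp_hasDerivAt t hQ
  have hne : 1 - (Q t).re ^ 2 - (Q t).im ^ 2 ≠ 0 := by
    have : (Q t).re ^ 2 + (Q t).im ^ 2 < 1 := by
      rw [← sq_lt_one_iff₀ (norm_nonneg _), ← normSq_eq_norm_sq, normSq_apply] at hQt
      nlinarith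
    linarith
  refine ((him.const_mul (-2)).div (((hre.pow 2).const_sub 1).sub (him.pow 2)) hne).congr_deriv ?_
  simp only [Pi.sub_apply, Pi.pow_apply]
  push_cast
  ring

lemma hasDerivAt_re_div {Q : ℝ → ℂ} {D : ℂ} {t : ℝ} (hQ : HasDerivAt Q D t) (hQt : ‖Q t‖ < 1) :
    HasDerivAt (fun τ => -2 * (Q τ).re / (1 - (Q τ).re ^ 2 - (Q τ).im ^ 2))
      (-2 * (D.re * (1 - (Q t).re ^ 2 - (Q t).im ^ 2)
        + 2 * (Q t).re * ((Q t).re * D.re + (Q t).im * D.im))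
        / (1 - (Q t).re ^ 2 - (Q t).im ^ 2) ^ 2) t := by
  have hre : HasDerivAt (fun τ => (Q τ).re) D.re t := reCLM.hasFDerivAt.comp_hasDerivAt t hQ
  have him : HasDerivAt (fun τ => (Q τ).im) D.im t := imCLM.hasFDerivAt.comp_hasDerivAt t hQ
  have hne : 1 - (Q t).re ^ 2 - (Q t).im ^ 2 ≠ 0 := by
    have : (Q t).re ^ 2 + (Q t).im ^ 2 < 1 := by
      rw [← sq_lt_one_iff₀ (norm_nonneg _), ← normSq_eq_norm_sq, normSq_apply] at hQt
      nlinarith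
    linarith
  refine ((hre.const_mul (-2)).div (((hre.pow 2).const_sub 1).sub (him.pow 2)) hne).congr_deriv ?_
  simp only [Pi.sub_apply, Pi.pow_apply]
  push_cast
  ring

namespace IsWeierstrassData

variable {h g k η q S : ℂ → ℂ}

lemma hasDerivAt_section
    (W : IsWeierstrassData h g k η q) (hSc : ContinuousOn S (ball 0 1))
    (hSm : ∀ w ∈ ball (0 : ℂ) 1, S w ∈ ball (0 : ℂ) 1)
    (hFS : ∀ w ∈ ball (0 : ℂ) 1, h (S w) + conj (g (S w)) = w)
    {γ : ℝ → ℂ} {t : ℝ} {e : ℂ} (hγ : HasDerivAt γ e t)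
    (hγt : γ t ∈ ball (0 : ℂ) 1) :
    HasDerivAt (fun τ => S (γ τ))
      ((e - conj (q (S (γ t))) ^ 2 * conj e) / (1 - ‖q (S (γ t))‖ ^ 4 : ℝ) / η (S (γ t))) t :=
  W.hasDerivAt_section_comp (hSc.continuousAt (isOpen_ball.mem_nhds hγt)) (hSm _ hγt)
    (Filter.eventually_of_mem (isOpen_ball.mem_nhds hγt) hFS) hγ rfl

lemma contDiffOn_heightGraph
    (W : IsWeierstrassData h g k η q) (hSc : ContinuousOn S (ball 0 1))
    (hSm : ∀ w ∈ ball (0 : ℂ) 1, S w ∈ ball (0 : ℂ) 1)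
    (hFS : ∀ w ∈ ball (0 : ℂ) 1, h (S w) + conj (g (S w)) = w) :
    ContDiffOn ℝ 2 (heightGraph k S) unitDisk := by
  intro p hp
  have hp' := toComplex_mem_ball.2 hp
  have hS := W.contDiffAt_section (hSc.continuousAt (isOpen_ball.mem_nhds hp')) (hSm _ hp')
    (Filter.eventually_of_mem (isOpen_ball.mem_nhds hp') hFS)
  have hk := contDiffAt_real_of_differentiableOn_ball
    (fun z hz => (W.hasDerivAt_k z hz).differentiableAt.differentiableWithinAt) (hSm _ hp')
  have hι : ContDiff ℝ 2 (fun p : ℝ × ℝ => (p.1 + p.2 * I : ℂ)) :=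
    (ofRealCLM.contDiff.comp contDiff_fst).add
      ((ofRealCLM.contDiff.comp contDiff_snd).mul contDiff_const)
  have h1 := reCLM.contDiff.contDiffAt.comp p ((hk.comp _ hS).comp p hι.contDiffAt)
  exact (contDiffAt_const.mul h1).contDiffWithinAt

lemma hasDerivAt_height
    (W : IsWeierstrassData h g k η q) (hSc : ContinuousOn S (ball 0 1))
    (hSm : ∀ w ∈ ball (0 : ℂ) 1, S w ∈ ball (0 : ℂ) 1)
    (hFS : ∀ w ∈ ball (0 : ℂ) 1, h (S w) + conj (g (S w)) = w)
    {γ : ℝ → ℂ} {t : ℝ} {e : ℂ} (hγ : HasDerivAt γ e t)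
    (hγt : γ t ∈ ball (0 : ℂ) 1) :
    HasDerivAt (fun τ => 2 * (k (S (γ τ))).re)
      (2 * (I * q (S (γ t)) * ((e - conj (q (S (γ t))) ^ 2 * conj e)
        / (1 - ‖q (S (γ t))‖ ^ 4 : ℝ))).re) t := by
  have h1 := (W.hasDerivAt_k _ (hSm _ hγt)).comp_of_eq t
    (W.hasDerivAt_section hSc hSm hFS hγ hγt) rfl
  have h2 := (reCLM.hasFDerivAt.comp_hasDerivAt t h1).const_mul 2
  refine h2.congr_deriv ?_
  have := W.ne_zero _ (hSm _ hγt)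
  simp only [reCLM_apply]
  congr 2
  field_simp

lemma hasDerivAt_gauss
    (W : IsWeierstrassData h g k η q) (hSc : ContinuousOn S (ball 0 1))
    (hSm : ∀ w ∈ ball (0 : ℂ) 1, S w ∈ ball (0 : ℂ) 1)
    (hFS : ∀ w ∈ ball (0 : ℂ) 1, h (S w) + conj (g (S w)) = w)
    {γ : ℝ → ℂ} {t : ℝ} {e : ℂ} (hγ : HasDerivAt γ e t)
    (hγt : γ t ∈ ball (0 : ℂ) 1) :
    HasDerivAt (fun τ => q (S (γ τ)))
      (deriv q (S (γ t)) / η (S (γ t)) * (e - conj (q (S (γ t))) ^ 2 * conj e)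
        / (1 - ‖q (S (γ t))‖ ^ 4 : ℝ)) t := by
  have h1 := ((W.differentiableOn_q.differentiableAt
    (isOpen_ball.mem_nhds (hSm _ hγt))).hasDerivAt).comp_of_eq t
    (W.hasDerivAt_section hSc hSm hFS hγ hγt) rfl
  refine h1.congr_deriv ?_
  ring

lemma one_sub_norm_pow_four_ne (W : IsWeierstrassData h g k η q)
    {z : ℂ} (hz : z ∈ ball (0 : ℂ) 1) :
    (1 : ℝ) - (q z).re ^ 2 - (q z).im ^ 2 ≠ 0 ∧
    (1 : ℝ) - ‖q z‖ ^ 4 ≠ 0 ∧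
      (1 : ℝ) - ‖q z‖ ^ 4 = (1 - (q z).re ^ 2 - (q z).im ^ 2) *
        (1 + (q z).re ^ 2 + (q z).im ^ 2) := by
  have h1 : ‖q z‖ ^ 2 < 1 := pow_lt_one₀ (norm_nonneg _) (W.norm_q_lt z hz) two_ne_zero
  have h2 : ‖q z‖ ^ 2 = (q z).re ^ 2 + (q z).im ^ 2 := by
    rw [← normSq_eq_norm_sq, normSq_apply]; ring
  have h3 : ‖q z‖ ^ 4 = ((q z).re ^ 2 + (q z).im ^ 2) ^ 2 := by rw [← h2]; ring
  refine ⟨by linarith, ?_, by rw [h3]; ring⟩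
  have : ‖q z‖ ^ 4 < 1 := pow_lt_one₀ (norm_nonneg _) (W.norm_q_lt z hz) (by norm_num)
  linarith

lemma pu_heightGraph
    (W : IsWeierstrassData h g k η q) (hSc : ContinuousOn S (ball 0 1))
    (hSm : ∀ w ∈ ball (0 : ℂ) 1, S w ∈ ball (0 : ℂ) 1)
    (hFS : ∀ w ∈ ball (0 : ℂ) 1, h (S w) + conj (g (S w)) = w)
    {p : ℝ × ℝ} (hp : p ∈ unitDisk) :
    pu (heightGraph k S) p = -2 * (q (S (p.1 + p.2 * I))).im /
      (1 - (q (S (p.1 + p.2 * I))).re ^ 2 - (q (S (p.1 + p.2 * I))).im ^ 2) := by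
  have hp' := toComplex_mem_ball.2 hp
  have h1 := (W.hasDerivAt_height hSc hSm hFS (hasDerivAt_horizontal p) hp').deriv
  refine h1.trans ?_
  obtain ⟨h2, h3, h4⟩ := W.one_sub_norm_pow_four_ne (hSm _ hp')
  rw [← mul_div_assoc, div_ofReal_re]
  rw [h4] at h3 ⊢
  generalize q (S (p.1 + p.2 * I)) = Q at *
  have h5 := right_ne_zero_of_mul h3
  simp [pow_two] at *
  field_simp
  ring

lemma pv_heightGraph
    (W : IsWeierstrassData h g k η q) (hSc : ContinuousOn S (ball 0 1))
    (hSm : ∀ w ∈ ball (0 : ℂ) 1, S w ∈ ball (0 : ℂ) 1)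
    (hFS : ∀ w ∈ ball (0 : ℂ) 1, h (S w) + conj (g (S w)) = w)
    {p : ℝ × ℝ} (hp : p ∈ unitDisk) :
    pv (heightGraph k S) p = -2 * (q (S (p.1 + p.2 * I))).re /
      (1 - (q (S (p.1 + p.2 * I))).re ^ 2 - (q (S (p.1 + p.2 * I))).im ^ 2) := by
  have hp' := toComplex_mem_ball.2 hp
  have h1 := (W.hasDerivAt_height hSc hSm hFS (hasDerivAt_vertical p) hp').deriv
  refine h1.trans ?_
  obtain ⟨h2, h3, h4⟩ := W.one_sub_norm_pow_four_ne (hSm _ hp')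
  rw [← mul_div_assoc, div_ofReal_re]
  rw [h4] at h3 ⊢
  generalize q (S (p.1 + p.2 * I)) = Q at *
  have h5 := right_ne_zero_of_mul h3
  simp [pow_two] at *
  field_simp
  ring

/-- The second derivatives of the height function in terms of the Gauss map `q` and of the
ratio `deriv q / η`. -/
lemma second_derivatives
    (W : IsWeierstrassData h g k η q) (hSc : ContinuousOn S (ball 0 1))
    (hSm : ∀ w ∈ ball (0 : ℂ) 1, S w ∈ ball (0 : ℂ) 1)
    (hFS : ∀ w ∈ ball (0 : ℂ) 1, h (S w) + conj (g (S w)) = w)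
    {p : ℝ × ℝ} (hp : p ∈ unitDisk) {x y a b : ℝ}
    (hQ : q (S (p.1 + p.2 * I)) = ⟨x, y⟩)
    (hκ : deriv q (S (p.1 + p.2 * I)) / η (S (p.1 + p.2 * I)) = ⟨a, b⟩) :
    1 - x ^ 2 - y ^ 2 ≠ 0 ∧
    pu (heightGraph k S) p = -2 * y / (1 - x ^ 2 - y ^ 2) ∧
    pv (heightGraph k S) p = -2 * x / (1 - x ^ 2 - y ^ 2) ∧
    pu (pu (heightGraph k S)) p =
      -2 * ((2 * a * x * y + b * (1 - x ^ 2 + y ^ 2)) * (1 - x ^ 2 - y ^ 2)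
        + 2 * y * (x * (a * (1 - x ^ 2 + y ^ 2) - 2 * b * x * y)
          + y * (2 * a * x * y + b * (1 - x ^ 2 + y ^ 2))))
        / ((1 - x ^ 2 - y ^ 2) ^ 3 * (1 + x ^ 2 + y ^ 2)) ∧
    pv (pu (heightGraph k S)) p =
      -2 * ((a * (1 + x ^ 2 - y ^ 2) + 2 * b * x * y) * (1 - x ^ 2 - y ^ 2)
        + 2 * y * (x * (2 * a * x * y - b * (1 + x ^ 2 - y ^ 2))
          + y * (a * (1 + x ^ 2 - y ^ 2) + 2 * b * x * y)))
        / ((1 - x ^ 2 - y ^ 2) ^ 3 * (1 + x ^ 2 + y ^ 2)) ∧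
    pv (pv (heightGraph k S)) p =
      -2 * ((2 * a * x * y - b * (1 + x ^ 2 - y ^ 2)) * (1 - x ^ 2 - y ^ 2)
        + 2 * x * (x * (2 * a * x * y - b * (1 + x ^ 2 - y ^ 2))
          + y * (a * (1 + x ^ 2 - y ^ 2) + 2 * b * x * y)))
        / ((1 - x ^ 2 - y ^ 2) ^ 3 * (1 + x ^ 2 + y ^ 2)) := by
  have hp' := toComplex_mem_ball.2 hp
  obtain ⟨h2, h3, h4⟩ := W.one_sub_norm_pow_four_ne (hSm _ hp')
  have hu := W.hasDerivAt_gauss hSc hSm hFS (hasDerivAt_horizontal p) hp'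
  have hv := W.hasDerivAt_gauss hSc hSm hFS (hasDerivAt_vertical p) hp'
  have hq := W.norm_q_lt _ (hSm _ hp')
  have huu := ((hasDerivAt_im_div hu hq).congr_of_eventuallyEq
    ((eventually_horizontal_mem hp).mono fun u hu => W.pu_heightGraph hSc hSm hFS hu)).deriv
  have huv := ((hasDerivAt_im_div hv hq).congr_of_eventuallyEq
    ((eventually_vertical_mem hp).mono fun u hu => W.pu_heightGraph hSc hSm hFS hu)).deriv
  have hvv := ((hasDerivAt_re_div hv hq).congr_of_eventuallyEq
    ((eventually_vertical_mem hp).mono fun u hu => W.pv_heightGraph hSc hSm hFS hu)).deriv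
  rw [W.pu_heightGraph hSc hSm hFS hp, W.pv_heightGraph hSc hSm hFS hp]
  rw [h4] at h3 huu huv hvv
  rw [hQ] at *
  rw [hκ] at *
  have h5 := right_ne_zero_of_mul h3
  simp only [div_ofReal_re, div_ofReal_im] at huu huv hvv
  simp only at huu huv hvv h2 h5
  refine ⟨h2, rfl, rfl, huu.trans ?_, huv.trans ?_, hvv.trans ?_⟩ <;>
  · simp [pow_two]
    simp only [← pow_two]
    field_simp
    ring

lemma isMinimalGraph_heightGraph
    (W : IsWeierstrassData h g k η q) (hSc : ContinuousOn S (ball 0 1))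
    (hSm : ∀ w ∈ ball (0 : ℂ) 1, S w ∈ ball (0 : ℂ) 1)
    (hFS : ∀ w ∈ ball (0 : ℂ) 1, h (S w) + conj (g (S w)) = w) :
    IsMinimalGraph (heightGraph k S) := by
  refine ⟨W.contDiffOn_heightGraph hSc hSm hFS, fun p hp => ?_⟩
  obtain ⟨hD, h1, h2, h3, h4, h5⟩ := W.second_derivatives hSc hSm hFS hp (Complex.eta _).symm (Complex.eta _).symm
  rw [h1, h2, h3, h4, h5]
  generalize (q (S (p.1 + p.2 * I))).re = x at *
  generalize (q (S (p.1 + p.2 * I))).im = y at *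
  generalize (deriv q (S (p.1 + p.2 * I)) / η (S (p.1 + p.2 * I))).re = a at *
  generalize (deriv q (S (p.1 + p.2 * I)) / η (S (p.1 + p.2 * I))).im = b at *
  have hN : 1 + x ^ 2 + y ^ 2 ≠ 0 := by positivity
  field_simp
  ring

/-- At a zero of the Gauss map, the graph is horizontal and its curvature is
`-4 * ‖deriv q / η‖ ^ 2`. -/
lemma curvature_heightGraph
    (W : IsWeierstrassData h g k η q) (hSc : ContinuousOn S (ball 0 1))
    (hSm : ∀ w ∈ ball (0 : ℂ) 1, S w ∈ ball (0 : ℂ) 1)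
    (hFS : ∀ w ∈ ball (0 : ℂ) 1, h (S w) + conj (g (S w)) = w)
    {p : ℝ × ℝ} (hp : p ∈ unitDisk) (hq : q (S (p.1 + p.2 * I)) = 0) :
    pu (heightGraph k S) p = 0 ∧ pv (heightGraph k S) p = 0 ∧
    pu (pu (heightGraph k S)) p * pv (pv (heightGraph k S)) p - pv (pu (heightGraph k S)) p ^ 2 =
      -(4 * ‖deriv q (S (p.1 + p.2 * I)) / η (S (p.1 + p.2 * I))‖ ^ 2) := by
  obtain ⟨hD, h1, h2, h3, h4, h5⟩ :=
    W.second_derivatives hSc hSm hFS hp (x := 0) (y := 0) (by rw [hq]; rfl)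
      (Complex.eta _).symm
  rw [h1, h2, h3, h4, h5, ← normSq_eq_norm_sq, normSq_apply]
  refine ⟨by simp, by simp, ?_⟩
  ring

end IsWeierstrassData

namespace IsWeierstrassData

variable {h g k η q : ℂ → ℂ}

/-- If the harmonic map pushes the unit circle outside the unit disk, then it is invertible over
the unit disk. -/
lemma exists_section (W : IsWeierstrassData h g k η q)
    (h0 : h 0 + conj (g 0) = 0)
    (hbd : ∀ ζ : ℂ, ‖ζ‖ = 1 → ∀ r < (1 : ℝ), ∀ᶠ z in 𝓝[ball 0 1] ζ, r < ‖h z + conj (g z)‖) :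
    ∃ S : ℂ → ℂ, ContinuousOn S (ball 0 1) ∧ (∀ w ∈ ball (0 : ℂ) 1, S w ∈ ball (0 : ℂ) 1) ∧
      (∀ w ∈ ball (0 : ℂ) 1, h (S w) + conj (g (S w)) = w) ∧ S 0 = 0 := by
  set F : ℂ → ℂ := fun z => h z + conj (g z) with hF
  have hFc : ContinuousOn F (ball 0 1) := fun z hz =>
    (W.contDiffAt hz).continuousAt.continuousWithinAt
  have hE : IsOpen (ball (0 : ℂ) 1 ∩ F ⁻¹' ball 0 1) := hFc.isOpen_inter_preimage isOpen_ball isOpen_ball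
  let E := ↥(ball (0 : ℂ) 1 ∩ F ⁻¹' ball 0 1)
  let X := ↥(ball (0 : ℂ) 1)
  let p : E → X := fun z => ⟨F z.1, z.2.2⟩
  have hpc : Continuous p :=
    (hFc.comp_continuous continuous_subtype_val fun z : E => z.2.1).subtype_mk _
  have hFl : IsLocalHomeomorph (fun z : E => F z.1) := by
    have h1 : IsLocalHomeomorphOn F (ball (0 : ℂ) 1 ∩ F ⁻¹' ball 0 1) := fun z hz => by
      obtain ⟨φ, hφ, hφF, -⟩ := W.exists_openPartialHomeomorph hz.1
      exact ⟨φ, hφ, hφF.symm⟩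
    have h2 : IsLocalHomeomorph (Subtype.val : E → ℂ) := hE.isOpenEmbedding_subtypeVal.isLocalHomeomorph
    rw [isLocalHomeomorph_iff_isLocalHomeomorphOn_univ] at h2 ⊢
    exact h1.comp h2 fun z _ => z.2
  have hpl : IsLocalHomeomorph p :=
    IsLocalHomeomorph.of_comp (g := (Subtype.val : X → ℂ)) hFl
      isOpen_ball.isOpenEmbedding_subtypeVal.isLocalHomeomorph hpc
  have hcomp : ∀ K : Set X, IsCompact K → IsCompact (p ⁻¹' K) := by
    intro K hK
    rw [Subtype.isCompact_iff] at hK ⊢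
    have himg : Subtype.val '' (p ⁻¹' K) = ball (0 : ℂ) 1 ∩ F ⁻¹' (Subtype.val '' K) := by
      ext z
      constructor
      · rintro ⟨w, hw, rfl⟩
        exact ⟨w.2.1, _, hw, rfl⟩
      · rintro ⟨hz, x, hx, hxz⟩
        exact ⟨⟨z, hz, by rw [Set.mem_preimage, ← hxz]; exact x.2⟩, by
          rw [Set.mem_preimage]; convert hx; exact Subtype.ext hxz.symm, rfl⟩
    rw [himg]
    obtain ⟨r, hr1, hr⟩ : ∃ r < (1 : ℝ), ∀ w ∈ Subtype.val '' K, ‖w‖ ≤ r := by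
      rcases (Subtype.val '' K).eq_empty_or_nonempty with hem | hne
      · exact ⟨0, one_pos, by simp [hem]⟩
      · obtain ⟨w, ⟨x, hx, rfl⟩, hmax⟩ := hK.exists_isMaxOn hne continuous_norm.continuousOn
        exact ⟨‖x.1‖, mem_ball_zero_iff.1 x.2, fun y hy => hmax hy⟩
    refine Metric.isCompact_of_isClosed_isBounded (isClosed_of_closure_subset fun z hz => ?_)
      (isBounded_ball.subset Set.inter_subset_left)
    have hz1 : ‖z‖ ≤ 1 := by
      have := closure_ball_subset_closedBall (closure_mono Set.inter_subset_left hz)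
      simpa using this
    rcases hz1.lt_or_eq with hlt | heq
    · have hzb : z ∈ ball (0 : ℂ) 1 := by simpa using hlt
      refine ⟨hzb, ?_⟩
      have hFz : ContinuousAt F z := (W.contDiffAt hzb).continuousAt
      exact hK.isClosed.closure_subset_iff.2 subset_rfl
        (hFz.continuousWithinAt.mem_closure hz fun y hy => hy.2)
    · exfalso
      have h1 : ∃ᶠ y in 𝓝 z, y ∈ ball (0 : ℂ) 1 ∩ F ⁻¹' (Subtype.val '' K) :=
        mem_closure_iff_frequently.1 hz
      have h2 := eventually_nhdsWithin_iff.1 (hbd z heq r hr1)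
      obtain ⟨y, hy, hy'⟩ := (h1.and_eventually h2).exists
      exact absurd (hr _ hy.2) (not_le.2 (hy' hy.1))
  have : LocallyCompactSpace X := isOpen_ball.locallyCompactSpace
  have hclosed : IsClosedMap p := (isProperMap_iff_isCompact_preimage.2 ⟨hpc, fun K hK => hcomp K hK⟩).isClosedMap
  have hcov : IsCoveringMapOn p Set.univ := by
    refine hclosed.isCoveringMapOn_of_isLocalHomeomorphOn (fun x _ => ?_) (by
      rw [Set.preimage_univ, ← isLocalHomeomorph_iff_isLocalHomeomorphOn_univ]; exact hpl)
    refine (hcomp _ isCompact_singleton).finite (.of_openPartialHomeomorph p subset_rfl fun e _ => ?_)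
    obtain ⟨φ, hφ, hφp⟩ := hpl e
    exact ⟨φ, hφ, hφp.symm⟩
  have : ContractibleSpace X := (convex_ball (0 : ℂ) 1).contractibleSpace ⟨0, by simp⟩
  have : LocallyPathConnectedSpace X := isOpen_ball.locallyPathConnectedSpace
  have hF0 : F 0 ∈ ball (0 : ℂ) 1 := by rw [hF]; simp [h0]
  obtain ⟨σ, ⟨hσ0, hσ⟩, -⟩ := hcov.existsUnique_continuousMap_lifts (ContinuousMap.id X)
    (a₀ := ⟨0, by simp⟩) (e₀ := ⟨0, by simp, hF0⟩) (Subtype.ext h0) (fun _ => trivial)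
  classical
  have hS : ∀ w (hw : w ∈ ball (0 : ℂ) 1),
      (fun w => if hw : w ∈ ball (0 : ℂ) 1 then (σ ⟨w, hw⟩).1 else 0) w = (σ ⟨w, hw⟩).1 :=
    fun w hw => dif_pos hw
  refine ⟨fun w => if hw : w ∈ ball (0 : ℂ) 1 then (σ ⟨w, hw⟩).1 else 0, ?_, ?_, ?_, ?_⟩
  · rw [continuousOn_iff_continuous_domRestrict]
    refine (continuous_subtype_val.comp σ.continuous).congr fun w => ?_
    exact (hS w.1 w.2).symm
  · intro w hw
    rw [hS w hw]
    exact (σ ⟨w, hw⟩).2.1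
  · intro w hw
    rw [hS w hw]
    exact congrArg Subtype.val (congrFun hσ ⟨w, hw⟩)
  · rw [hS 0 (by simp), hσ0]

end IsWeierstrassData

/-- `arcLog δ` has on the unit circle, up to the constant `δ`, imaginary part `π` on the arc
`cos δ < re z` and `0` on the complementary arc. -/
noncomputable def arcLog (δ : ℝ) (z : ℂ) : ℂ :=
  log (1 - z * exp (-(δ * I))) - log (1 - z * exp (δ * I))

/-- `π` times the harmonic measure, seen from `z`, of the arc `cos δ < re ζ` of the unit circle. -/
noncomputable def arcAngle (δ : ℝ) (z : ℂ) : ℝ := δ + (arcLog δ z).im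

lemma re_one_sub_pos {w : ℂ} (hw : ‖w‖ ≤ 1) (hw1 : w ≠ 1) : 0 < (1 - w).re := by
  rw [sub_re, one_re, sub_pos]
  refine lt_of_le_of_ne ((re_le_norm w).trans hw) fun h => hw1 ?_
  have h2 : w.re * w.re + w.im * w.im ≤ 1 := by
    rw [← normSq_apply, normSq_eq_norm_sq]
    exact pow_le_one₀ (norm_nonneg w) hw
  exact Complex.ext h (mul_self_eq_zero.1 (by rw [h] at h2; nlinarith [mul_self_nonneg w.im]))

lemma norm_mul_exp_neg (z : ℂ) (δ : ℝ) : ‖z * exp (-(δ * I))‖ = ‖z‖ := by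
  rw [norm_mul, ← neg_mul, ← ofReal_neg, norm_exp_ofReal_mul_I, mul_one]

lemma norm_mul_exp (z : ℂ) (δ : ℝ) : ‖z * exp (δ * I)‖ = ‖z‖ := by
  rw [norm_mul, norm_exp_ofReal_mul_I, mul_one]

lemma ne_one_of_norm_lt {w : ℂ} (hw : ‖w‖ < 1) : w ≠ 1 := by
  rintro rfl
  simp at hw

lemma one_sub_mul_exp_ne_zero (δ : ℝ) {z : ℂ} (hz : ‖z‖ < 1) :
    1 - z * exp (-(δ * I)) ≠ 0 ∧ 1 - z * exp (δ * I) ≠ 0 :=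
  ⟨sub_ne_zero.2 (ne_one_of_norm_lt ((norm_mul_exp_neg z δ).trans_lt hz)).symm,
    sub_ne_zero.2 (ne_one_of_norm_lt ((norm_mul_exp z δ).trans_lt hz)).symm⟩

lemma one_sub_two_cos_mul_add_sq (δ : ℝ) (z : ℂ) : 1 - 2 * Real.cos δ * z + z ^ 2
    = (1 - z * exp (-(δ * I))) * (1 - z * exp (δ * I)) := by
  have he : exp (-(δ * I)) * exp (δ * I) = 1 := by rw [← Complex.exp_add]; simp
  have hc : 2 * (Real.cos δ : ℂ) = exp (δ * I) + exp (-(δ * I)) := by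
    rw [← neg_mul, exp_mul_I, exp_mul_I]; simp; ring
  rw [hc]
  linear_combination (-z ^ 2) * he

lemma one_sub_two_cos_mul_add_sq_ne_zero (δ : ℝ) {z : ℂ} (hz : ‖z‖ < 1) :
    1 - 2 * Real.cos δ * z + z ^ 2 ≠ 0 := by
  rw [one_sub_two_cos_mul_add_sq]
  exact mul_ne_zero (one_sub_mul_exp_ne_zero δ hz).1 (one_sub_mul_exp_ne_zero δ hz).2

lemma hasDerivAt_arcLog (δ : ℝ) {z : ℂ} (hz : ‖z‖ < 1) :
    HasDerivAt (arcLog δ) (2 * I * Real.sin δ / (1 - 2 * Real.cos δ * z + z ^ 2)) z := by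
  have hm := re_one_sub_pos ((norm_mul_exp_neg z δ).trans_le hz.le)
    (ne_one_of_norm_lt ((norm_mul_exp_neg z δ).trans_lt hz))
  have hp := re_one_sub_pos ((norm_mul_exp z δ).trans_le hz.le)
    (ne_one_of_norm_lt ((norm_mul_exp z δ).trans_lt hz))
  have h1 := (((hasDerivAt_id z).mul_const (exp (-(δ * I)))).const_sub 1).clog (Or.inl hm)
  have h2 := (((hasDerivAt_id z).mul_const (exp (δ * I))).const_sub 1).clog (Or.inl hp)
  obtain ⟨hm0, hp0⟩ := one_sub_mul_exp_ne_zero δ hz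
  have hs : 2 * I * Real.sin δ = exp (δ * I) - exp (-(δ * I)) := by
    rw [← neg_mul, exp_mul_I, exp_mul_I]; simp; ring
  convert! h1.sub h2 using 1
  rw [one_sub_two_cos_mul_add_sq, hs]
  simp only [id]
  rw [div_sub_div _ _ hm0 hp0]
  congr 1
  ring

section arcAngle

variable {δ : ℝ} {z : ℂ}

lemma continuousAt_arcAngle (hz : ‖z‖ ≤ 1) (hm : z * exp (-(δ * I)) ≠ 1)
    (hp : z * exp (δ * I) ≠ 1) : ContinuousAt (arcAngle δ) z := by
  have hm' := re_one_sub_pos ((norm_mul_exp_neg z δ).trans_le hz) hm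
  have hp' := re_one_sub_pos ((norm_mul_exp z δ).trans_le hz) hp
  unfold arcAngle arcLog
  refine continuousAt_const.add (continuous_im.continuousAt.comp (.sub ?_ ?_))
  · exact ContinuousAt.clog (by fun_prop) (Or.inl hm')
  · exact ContinuousAt.clog (by fun_prop) (Or.inl hp')

lemma exists_arcAngle (hz : ‖z‖ ≤ 1) (hm : z * exp (-(δ * I)) ≠ 1)
    (hp : z * exp (δ * I) ≠ 1) :
    ∃ N : ℝ, 0 < N ∧ N * Real.sin (arcAngle δ z) = Real.sin δ * (1 - ‖z‖ ^ 2) ∧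
      N * Real.cos (arcAngle δ z) = Real.cos δ * (1 + ‖z‖ ^ 2) - 2 * z.re ∧
      δ - π < arcAngle δ z ∧ arcAngle δ z < δ + π := by
  have hm' := re_one_sub_pos ((norm_mul_exp_neg z δ).trans_le hz) hm
  have hp' := re_one_sub_pos ((norm_mul_exp z δ).trans_le hz) hp
  set u := 1 - z * exp (-(δ * I)) with hu
  set v := 1 - z * exp (δ * I) with hv
  have hA : arcAngle δ z = δ + (arg u - arg v) := by
    rw [arcAngle, arcLog, sub_im, log_im, log_im]
  have hu0 : u ≠ 0 := fun h => by simp [h] at hm'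
  have hv0 : v ≠ 0 := fun h => by simp [h] at hp'
  have hexp : ((‖u‖ * ‖v‖ : ℝ) : ℂ) * exp (arcAngle δ z * I) = exp (δ * I) * u * conj v := by
    have h1 : conj v = ‖v‖ * exp (-(arg v * I)) := by
      conv_lhs => rw [← norm_mul_exp_arg_mul_I v]
      rw [map_mul, conj_ofReal, ← exp_conj]; simp
    rw [h1]
    conv_rhs => rw [← norm_mul_exp_arg_mul_I u]
    rw [hA]
    push_cast
    rw [show ((δ : ℂ) + (arg u - arg v)) * I = δ * I + arg u * I + -(arg v * I) by ring,
      Complex.exp_add, Complex.exp_add]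
    ring
  have hrhs : exp (δ * I) * u * conj v
      = exp (δ * I) - 2 * z.re + (‖z‖ ^ 2 : ℝ) * exp (-(δ * I)) := by
    have he : exp (-(δ * I)) * exp (δ * I) = 1 := by rw [← Complex.exp_add]; simp
    have hcv : conj v = 1 - conj z * exp (-(δ * I)) := by
      rw [hv, map_sub, map_one, map_mul, ← exp_conj]; simp
    have hzz : ((‖z‖ ^ 2 : ℝ) : ℂ) = z * conj z := by
      rw [mul_conj, normSq_eq_norm_sq]
    have hre : (2 * z.re : ℂ) = z + conj z := by rw [add_conj]; simp
    rw [hcv, hzz, hre, hu]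
    linear_combination (-(z + conj z) + z * conj z * exp (-(δ * I))) * he
  rw [hrhs] at hexp
  rw [← neg_mul, exp_mul_I, exp_mul_I, exp_mul_I, Complex.cos_neg, Complex.sin_neg, ← ofReal_cos, ← ofReal_sin,
    ← ofReal_cos, ← ofReal_sin] at hexp
  have hr := congrArg re hexp
  have hi := congrArg im hexp
  simp [-ofReal_cos, -ofReal_sin, -ofReal_pow] at hr hi
  have b1 := abs_lt.1 (abs_arg_lt_pi_div_two_iff.2 (Or.inl hm'))
  have b2 := abs_lt.1 (abs_arg_lt_pi_div_two_iff.2 (Or.inl hp'))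
  refine ⟨‖u‖ * ‖v‖, by positivity, by linarith, by linarith, ?_, ?_⟩ <;> rw [hA] <;> linarith

lemma arcAngle_pos (h0 : 0 < δ) (hπ : δ < π) (hz : ‖z‖ < 1) : 0 < arcAngle δ z := by
  obtain ⟨N, hN, hs, -, h1, h2⟩ := exists_arcAngle hz.le
    (ne_one_of_norm_lt ((norm_mul_exp_neg z δ).trans_lt hz))
    (ne_one_of_norm_lt ((norm_mul_exp z δ).trans_lt hz))
  by_contra! h
  have h3 : 0 < N * Real.sin (arcAngle δ z) := by
    rw [hs]
    exact mul_pos (Real.sin_pos_of_pos_of_lt_pi h0 hπ) (by nlinarith [norm_nonneg z])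
  have h4 := Real.sin_nonpos_of_nonpos_of_neg_pi_le h (by linarith)
  nlinarith

lemma re_eq_cos_of_mul_exp_eq_one (h : z * exp (δ * I) = 1) : z.re = Real.cos δ := by
  have : z = exp (((-δ : ℝ) : ℂ) * I) := by
    rw [eq_comm, ofReal_neg, neg_mul, Complex.exp_neg]
    exact (eq_inv_of_mul_eq_one_left h).symm
  rw [this, exp_ofReal_mul_I_re, Real.cos_neg]

lemma mul_exp_ne_one (h : z.re ≠ Real.cos δ) :
    z * exp (-(δ * I)) ≠ 1 ∧ z * exp (δ * I) ≠ 1 := by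
  refine ⟨fun h' => h ?_, fun h' => h (re_eq_cos_of_mul_exp_eq_one h')⟩
  rw [← neg_mul, ← ofReal_neg] at h'
  simpa using re_eq_cos_of_mul_exp_eq_one h'

lemma tendsto_arcAngle_pi (h0 : 0 < δ) (hπ : δ < π) (hz : ‖z‖ = 1) (hre : Real.cos δ < z.re) :
    Filter.Tendsto (arcAngle δ) (𝓝 z) (𝓝 π) := by
  obtain ⟨hm, hp⟩ := mul_exp_ne_one hre.ne'
  obtain ⟨N, hN, hs, hc, h1, h2⟩ := exists_arcAngle hz.le hm hp
  have hs0 : Real.sin (arcAngle δ z) = 0 := by simpa [hz, hN.ne'] using hs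
  have hc0 : Real.cos (arcAngle δ z) < 0 := by
    rw [hz] at hc; by_contra! h; nlinarith [mul_nonneg hN.le h]
  have : arcAngle δ z = π := by
    have h3 : Real.sin (arcAngle δ z - π) = 0 := by rw [Real.sin_sub_pi, hs0, neg_zero]
    rcases lt_or_ge (arcAngle δ z) 0 with h | h
    · have := (Real.sin_eq_zero_iff_of_lt_of_lt (by linarith) (by linarith)).1 hs0
      linarith
    · rcases h.eq_or_lt with h | h
      · rw [← h, Real.cos_zero] at hc0; linarith
      · have := (Real.sin_eq_zero_iff_of_lt_of_lt (by linarith) (by linarith)).1 h3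
        linarith
  have h := continuousAt_arcAngle hz.le hm hp
  rwa [ContinuousAt, this] at h

lemma tendsto_arcAngle_zero (h0 : 0 < δ) (hπ : δ < π) (hz : ‖z‖ = 1) (hre : z.re < Real.cos δ) :
    Filter.Tendsto (arcAngle δ) (𝓝 z) (𝓝 0) := by
  obtain ⟨hm, hp⟩ := mul_exp_ne_one hre.ne
  obtain ⟨N, hN, hs, hc, h1, h2⟩ := exists_arcAngle hz.le hm hp
  have hs0 : Real.sin (arcAngle δ z) = 0 := by simpa [hz, hN.ne'] using hs
  have hc0 : 0 < Real.cos (arcAngle δ z) := by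
    rw [hz] at hc; by_contra! h; nlinarith [mul_nonpos_of_nonneg_of_nonpos hN.le h]
  have : arcAngle δ z = 0 := by
    have h3 : Real.sin (arcAngle δ z - π) = 0 := by rw [Real.sin_sub_pi, hs0, neg_zero]
    rcases lt_or_ge (arcAngle δ z) π with h | h
    · exact (Real.sin_eq_zero_iff_of_lt_of_lt (by linarith) (by linarith)).1 hs0
    · have := (Real.sin_eq_zero_iff_of_lt_of_lt (by linarith) (by linarith)).1 h3
      rw [show arcAngle δ z = π by linarith, Real.cos_pi] at hc0
      linarith
  have h := continuousAt_arcAngle hz.le hm hp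
  rwa [ContinuousAt, this] at h

end arcAngle

/-- Its real part is `2 * arcAngle (π / 2) z - π + a * (arcAngle δ z - arcAngle δ (-z))`. -/
noncomputable def scherkLog (a δ : ℝ) (z : ℂ) : ℂ :=
  -I * (2 * arcLog (π / 2) z + a * (arcLog δ z - arcLog δ (-z)))

section scherkLog

variable {a δ : ℝ}

lemma hasDerivAt_scherkLog (a δ : ℝ) {z : ℂ} (hz : ‖z‖ < 1) :
    HasDerivAt (scherkLog a δ) (4 / (1 + z ^ 2) + 2 * a * Real.sin δ *
      (1 / (1 - 2 * Real.cos δ * z + z ^ 2) + 1 / (1 + 2 * Real.cos δ * z + z ^ 2))) z := by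
  have h1 := hasDerivAt_arcLog (π / 2) hz
  have h2 := hasDerivAt_arcLog δ hz
  have h3 := (hasDerivAt_arcLog δ (z := -z) (by rwa [norm_neg])).comp z (hasDerivAt_neg z)
  convert! ((h1.const_mul 2).add ((h2.sub h3).const_mul (a : ℂ))).const_mul (-I) using 1
  rw [Real.cos_pi_div_two, Real.sin_pi_div_two]
  simp only [ofReal_zero, ofReal_one]
  rw [show 1 - 2 * (Real.cos δ : ℂ) * -z + (-z) ^ 2 = 1 + 2 * Real.cos δ * z + z ^ 2 by ring,
    show 1 - 2 * (0 : ℂ) * z + z ^ 2 = 1 + z ^ 2 by ring]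
  linear_combination (4 / (1 + z ^ 2) + 2 * a * Real.sin δ *
      (1 / (1 - 2 * Real.cos δ * z + z ^ 2) + 1 / (1 + 2 * Real.cos δ * z + z ^ 2))) * I_mul_I

lemma re_scherkLog (a δ : ℝ) (z : ℂ) : (scherkLog a δ z).re
    = 2 * arcAngle (π / 2) z - π + a * (arcAngle δ z - arcAngle δ (-z)) := by
  simp [scherkLog, arcAngle]
  ring

lemma scherkLog_neg (a δ : ℝ) (z : ℂ) : scherkLog a δ (-z) = -scherkLog a δ z := by
  have h : arcLog (π / 2) (-z) = -arcLog (π / 2) z := by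
    have h1 : exp (((π / 2 : ℝ) : ℂ) * I) = I := by push_cast; exact exp_pi_div_two_mul_I
    have h2 : exp (-(((π / 2 : ℝ) : ℂ) * I)) = -I := by rw [Complex.exp_neg, h1, inv_I]
    rw [arcLog, arcLog, h1, h2]
    ring_nf
  rw [scherkLog, scherkLog, h, neg_neg]
  ring

/-- Near the boundary point `ζ`, the harmonic map whose coordinates are the real parts of
`scherkLog` at `z` and `I * z` does not enter any disk of radius less than `√2 * π`. -/
def AvoidsDisk (a δ : ℝ) (ζ : ℂ) : Prop :=
  ∀ r < 2 * π ^ 2, ∀ᶠ z in 𝓝[ball 0 1] ζ,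
    r < (scherkLog a δ z).re ^ 2 + (scherkLog a δ (I * z)).re ^ 2

lemma AvoidsDisk.of_I_mul {ζ : ℂ} (h : AvoidsDisk a δ (I * ζ)) : AvoidsDisk a δ ζ := by
  intro r hr
  have ht : Filter.Tendsto (fun z : ℂ => I * z) (𝓝[ball 0 1] ζ) (𝓝[ball 0 1] (I * ζ)) := by
    refine tendsto_nhdsWithin_iff.2 ⟨?_, ?_⟩
    · exact ((continuous_const_mul I).tendsto ζ).mono_left nhdsWithin_le_nhds
    · filter_upwards [self_mem_nhdsWithin] with z hz
      simpa using hz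
  filter_upwards [ht.eventually (h r hr)] with z hz
  rw [← mul_assoc, I_mul_I, neg_one_mul, scherkLog_neg, neg_re, neg_sq] at hz
  linarith

/-- The boundary estimate on the quarter of the circle around `1`. -/
lemma avoidsDisk_of_abs_im_le (ha : 1 ≤ a) (h0 : 0 < δ) (hδ : δ < π / 4) {ζ : ℂ} (hζ : ‖ζ‖ = 1)
    (hre : |ζ.im| ≤ ζ.re) : AvoidsDisk a δ ζ := by
  have hπ := Real.pi_pos
  have hsq : ζ.re * ζ.re + ζ.im * ζ.im = 1 := by rw [← normSq_apply, normSq_eq_norm_sq, hζ]; norm_num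
  have hre0 : 0 < ζ.re := by
    by_contra! h
    have h1 : ζ.im = 0 := abs_eq_zero.1 (le_antisymm (hre.trans h) (abs_nonneg _))
    have h2 : ζ.re = 0 := le_antisymm h ((abs_nonneg _).trans hre)
    rw [h1, h2] at hsq
    norm_num at hsq
  have hcos : 1 / 2 < Real.cos δ ^ 2 := by
    rw [Real.cos_sq]
    have := Real.cos_pos_of_mem_Ioo (x := 2 * δ) ⟨by linarith, by linarith⟩
    linarith
  have hcos0 : 0 < Real.cos δ := Real.cos_pos_of_mem_Ioo ⟨by linarith, by linarith⟩
  have him : |ζ.im| < Real.cos δ := by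
    refine abs_lt_of_sq_lt_sq ?_ hcos0.le
    have := mul_self_le_mul_self (abs_nonneg _) hre
    rw [abs_mul_abs_self] at this
    nlinarith
  have hneg : Filter.Tendsto (fun z : ℂ => -z) (𝓝 ζ) (𝓝 (-ζ)) := continuous_neg.tendsto ζ
  have hI : Filter.Tendsto (fun z : ℂ => I * z) (𝓝 ζ) (𝓝 (I * ζ)) :=
    (continuous_const_mul I).tendsto ζ
  have hnI : Filter.Tendsto (fun z : ℂ => -(I * z)) (𝓝 ζ) (𝓝 (-(I * ζ))) := hI.neg
  have t1 : Filter.Tendsto (arcAngle (π / 2)) (𝓝 ζ) (𝓝 π) :=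
    tendsto_arcAngle_pi (by linarith) (by linarith) hζ (by rwa [Real.cos_pi_div_two])
  have t2 : Filter.Tendsto (fun z => arcAngle δ (-z)) (𝓝 ζ) (𝓝 0) :=
    (tendsto_arcAngle_zero h0 (by linarith) (by rwa [norm_neg])
      (by rw [neg_re]; linarith)).comp hneg
  intro r hr
  by_cases h1 : ζ.im = 0
  · have hζ1 : Real.cos δ < ζ.re := by
      rw [h1] at hsq
      have : ζ.re = 1 := by nlinarith
      rw [this]
      refine lt_of_le_of_ne (Real.cos_le_one δ) fun h => ?_
      have := Real.cos_lt_cos_of_nonneg_of_le_pi le_rfl (by linarith) h0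
      rw [Real.cos_zero] at this
      linarith
    have t3 : Filter.Tendsto (arcAngle δ) (𝓝 ζ) (𝓝 π) :=
      tendsto_arcAngle_pi h0 (by linarith) hζ hζ1
    have t := ((((t1.const_mul 2).sub_const π).add ((t3.sub t2).const_mul a)).pow 2)
      |>.eventually_const_lt (u := r) (by
        have := mul_nonneg (sub_nonneg.2 ha) (sq_nonneg π)
        nlinarith [mul_nonneg (sub_nonneg.2 ha) this])
    filter_upwards [t.filter_mono nhdsWithin_le_nhds] with z hz
    rw [← re_scherkLog] at hz
    nlinarith [sq_nonneg (scherkLog a δ (I * z)).re]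
  · have t4 : Filter.Tendsto (fun z => arcAngle δ (I * z)) (𝓝 ζ) (𝓝 0) :=
      (tendsto_arcAngle_zero h0 (by linarith) (by simpa using hζ)
        (by simpa using (neg_le_abs _).trans_lt him)).comp hI
    have t5 : Filter.Tendsto (fun z => arcAngle δ (-(I * z))) (𝓝 ζ) (𝓝 0) :=
      (tendsto_arcAngle_zero h0 (by linarith) (by simpa using hζ)
        (by simpa using (le_abs_self _).trans_lt him)).comp hnI
    have t6 : Filter.Tendsto (fun z => (scherkLog a δ (I * z)).re ^ 2) (𝓝 ζ) (𝓝 (π ^ 2)) := by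
      simp only [re_scherkLog]
      rcases lt_or_gt_of_ne h1 with h | h
      · have t7 : Filter.Tendsto (fun z => arcAngle (π / 2) (I * z)) (𝓝 ζ) (𝓝 π) :=
          (tendsto_arcAngle_pi (by linarith) (by linarith) (by simpa using hζ)
            (by simpa [Real.cos_pi_div_two] using h)).comp hI
        convert (((t7.const_mul 2).sub_const π).add ((t4.sub t5).const_mul a)).pow 2 using 2
        ring
      · have t7 : Filter.Tendsto (fun z => arcAngle (π / 2) (I * z)) (𝓝 ζ) (𝓝 0) :=
          (tendsto_arcAngle_zero (by linarith) (by linarith) (by simpa using hζ)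
            (by simpa [Real.cos_pi_div_two] using h)).comp hI
        convert (((t7.const_mul 2).sub_const π).add ((t4.sub t5).const_mul a)).pow 2 using 2
        ring
    have t8 := ((t1.const_mul 2).sub_const π).sub (t2.const_mul a)
    have e1 := t8.eventually_const_lt (u := 0) (by linarith)
    have e2 := ((t8.pow 2).add t6).eventually_const_lt (u := r) (by nlinarith)
    filter_upwards [e1.filter_mono nhdsWithin_le_nhds, e2.filter_mono nhdsWithin_le_nhds,
      self_mem_nhdsWithin] with z h1 h2 h3
    have h4 := arcAngle_pos h0 (by linarith) (mem_ball_zero_iff.1 h3)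
    have h5 := re_scherkLog a δ z
    have h6 := mul_pos (one_pos.trans_le ha) h4
    nlinarith

lemma avoidsDisk (ha : 1 ≤ a) (h0 : 0 < δ) (hδ : δ < π / 4) {ζ : ℂ} (hζ : ‖ζ‖ = 1) :
    AvoidsDisk a δ ζ := by
  rcases le_total |ζ.im| |ζ.re| with h | h
  · rcases le_total 0 ζ.re with h' | h'
    · exact avoidsDisk_of_abs_im_le ha h0 hδ hζ (h.trans_eq (abs_of_nonneg h'))
    · refine AvoidsDisk.of_I_mul (AvoidsDisk.of_I_mul ?_)
      rw [← mul_assoc, I_mul_I, neg_one_mul]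
      exact avoidsDisk_of_abs_im_le ha h0 hδ (by rwa [norm_neg])
        (by simpa [abs_of_nonpos h'] using h)
  · rcases le_total 0 ζ.im with h' | h'
    · refine AvoidsDisk.of_I_mul (AvoidsDisk.of_I_mul (AvoidsDisk.of_I_mul ?_))
      exact avoidsDisk_of_abs_im_le ha h0 hδ (by simpa using hζ)
        (by simpa [abs_of_nonneg h'] using h)
    · refine AvoidsDisk.of_I_mul ?_
      exact avoidsDisk_of_abs_im_le ha h0 hδ (by simpa using hζ)
        (by simpa [abs_of_nonpos h'] using h)

end scherkLog

/-- The parameter `β` of the dilatation `(I * z * (z ^ 4 - β) / (1 - β * z ^ 4)) ^ 2`. -/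
noncomputable def dilParam (s : ℝ) : ℝ := (1 - 2 * s - 4 * s ^ 2) / (1 + 2 * s)

/-- The weight of the arcs of half-width `δ`, chosen so that the dilatation is a square. -/
noncomputable def arcWeight (s : ℝ) : ℝ := 2 * (1 - 2 * s ^ 2) / (1 + s)

/-- The normalized derivative at `0` of the analytic part of the harmonic map. -/
noncomputable def derivParam (s : ℝ) : ℝ := (1 - s) * (1 + 2 * s) ^ 2 / (1 + s)

/-- The product of the linear factors corresponding to the jumps of the harmonic map. -/
def jumpPoly (s : ℝ) (z : ℂ) : ℂ :=
  (1 - z ^ 4) * (((1 + z ^ 2) ^ 2 - 4 * (1 - s ^ 2) * z ^ 2) *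
    ((1 - z ^ 2) ^ 2 + 4 * (1 - s ^ 2) * z ^ 2))

/-- The derivative of the unscaled analytic part of the harmonic map. -/
noncomputable def scherkDeriv (s : ℝ) (z : ℂ) : ℂ :=
  8 * derivParam s * (1 - dilParam s * z ^ 4) ^ 2 / jumpPoly s z

/-- The square root of the dilatation of the harmonic map. -/
noncomputable def sqrtDil (s : ℝ) (z : ℂ) : ℂ :=
  I * z * (z ^ 4 - dilParam s) / (1 - dilParam s * z ^ 4)

section data

variable {s : ℝ} {z : ℂ}

lemma cos_arcsin_sq (h0 : 0 < s) (h1 : s < 1 / 10) :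
    ((Real.cos (Real.arcsin s) : ℝ) : ℂ) ^ 2 = 1 - s ^ 2 := by
  rw [Real.cos_arcsin, ← ofReal_pow, Real.sq_sqrt (by nlinarith)]
  push_cast
  rfl

lemma dilParam_mem_Ioo (h0 : 0 < s) (h1 : s < 1 / 10) : 0 < dilParam s ∧ dilParam s < 1 := by
  refine ⟨div_pos (by nlinarith) (by linarith), ?_⟩
  rw [dilParam, div_lt_one (by linarith)]
  nlinarith

lemma one_sub_dilParam_mul_ne_zero (h0 : 0 < s) (h1 : s < 1 / 10) (hz : ‖z‖ < 1) :
    1 - dilParam s * z ^ 4 ≠ 0 := by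
  obtain ⟨hb0, hb1⟩ := dilParam_mem_Ioo h0 h1
  refine sub_ne_zero.2 (ne_one_of_norm_lt ?_).symm
  rw [norm_mul, norm_real, Real.norm_of_nonneg hb0.le, norm_pow]
  exact mul_lt_one_of_nonneg_of_lt_one_left hb0.le hb1 (pow_le_one₀ (norm_nonneg z) hz.le)

lemma one_add_sq_ne_zero (hz : ‖z‖ < 1) : 1 + z ^ 2 ≠ 0 := by
  have := ne_one_of_norm_lt (w := -z ^ 2)
    (by rw [norm_neg, norm_pow]; exact pow_lt_one₀ (norm_nonneg z) hz two_ne_zero)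
  intro h
  exact this (by linear_combination -h)

lemma norm_neg_I_mul (hz : ‖z‖ < 1) : ‖-I * z‖ < 1 := by simpa using hz

lemma jumpPoly_factor (h0 : 0 < s) (h1 : s < 1 / 10) (hz : ‖z‖ < 1) :
    (1 + z ^ 2) ^ 2 - 4 * (1 - s ^ 2) * z ^ 2
      = (1 - 2 * Real.cos (Real.arcsin s) * z + z ^ 2) *
        (1 + 2 * Real.cos (Real.arcsin s) * z + z ^ 2) ∧
    1 - 2 * Real.cos (Real.arcsin s) * z + z ^ 2 ≠ 0 ∧
    1 + 2 * Real.cos (Real.arcsin s) * z + z ^ 2 ≠ 0 := by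
  refine ⟨by rw [← cos_arcsin_sq h0 h1]; ring, one_sub_two_cos_mul_add_sq_ne_zero _ hz, ?_⟩
  have := one_sub_two_cos_mul_add_sq_ne_zero (Real.arcsin s) (z := -z) (by rwa [norm_neg])
  intro h
  exact this (by linear_combination h)

lemma hasDerivAt_scherkLog_arcsin (h0 : 0 < s) (h1 : s < 1 / 10) (hz : ‖z‖ < 1) :
    HasDerivAt (scherkLog (arcWeight s) (Real.arcsin s))
      (4 / (1 + z ^ 2) + 4 * arcWeight s * s * (1 + z ^ 2) /
        ((1 + z ^ 2) ^ 2 - 4 * (1 - s ^ 2) * z ^ 2)) z := by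
  obtain ⟨hf, hn, hp⟩ := jumpPoly_factor h0 h1 hz
  convert! hasDerivAt_scherkLog (arcWeight s) (Real.arcsin s) hz using 1
  rw [hf, Real.sin_arcsin (by linarith) (by linarith), div_add_div _ _ hn hp]
  congr 1
  rw [mul_div_assoc']
  congr 1
  ring

lemma jumpPoly_ne_zero (h0 : 0 < s) (h1 : s < 1 / 10) (hz : ‖z‖ < 1) : jumpPoly s z ≠ 0 := by
  obtain ⟨hf, hn, hp⟩ := jumpPoly_factor h0 h1 hz
  obtain ⟨hf', hn', hp'⟩ := jumpPoly_factor h0 h1 (norm_neg_I_mul hz)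
  have e : (-I * z) ^ 2 = -z ^ 2 := by rw [mul_pow, neg_sq, I_sq]; ring
  rw [e] at hf'
  refine mul_ne_zero ?_ (mul_ne_zero ?_ ?_)
  · have := mul_ne_zero (one_add_sq_ne_zero hz) (one_add_sq_ne_zero (norm_neg_I_mul hz))
    rw [e] at this
    convert this using 1
    ring
  · rw [hf]
    exact mul_ne_zero hn hp
  · rw [show (1 - z ^ 2) ^ 2 + 4 * (1 - (s : ℂ) ^ 2) * z ^ 2
      = (1 + -z ^ 2) ^ 2 - 4 * (1 - s ^ 2) * (-z ^ 2) by ring, hf', ← e]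
    exact mul_ne_zero hn' hp'

/-- The two rational identities behind the choice of the parameters. -/
lemma jump_identities {s y P P' : ℂ} (hs : 1 + s ≠ 0) (hs' : 1 + 2 * s ≠ 0) (hy : 1 + y ≠ 0)
    (hy' : 1 - y ≠ 0) (hP0 : P ≠ 0) (hP0' : P' ≠ 0) (hP : P = (1 + y) ^ 2 - 4 * (1 - s ^ 2) * y)
    (hP' : P' = (1 - y) ^ 2 + 4 * (1 - s ^ 2) * y) :
    4 / (1 + y) + 4 * (2 * (1 - 2 * s ^ 2) / (1 + s)) * s * (1 + y) / P +
      (4 / (1 - y) + 4 * (2 * (1 - 2 * s ^ 2) / (1 + s)) * s * (1 - y) / P') =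
      8 * ((1 - s) * (1 + 2 * s) ^ 2 / (1 + s)) *
        (1 - (1 - 2 * s - 4 * s ^ 2) / (1 + 2 * s) * y ^ 2) ^ 2 / ((1 - y ^ 2) * (P * P')) ∧
    4 / (1 + y) + 4 * (2 * (1 - 2 * s ^ 2) / (1 + s)) * s * (1 + y) / P -
      (4 / (1 - y) + 4 * (2 * (1 - 2 * s ^ 2) / (1 + s)) * s * (1 - y) / P') =
      -(8 * ((1 - s) * (1 + 2 * s) ^ 2 / (1 + s)) * y *
        (y ^ 2 - (1 - 2 * s - 4 * s ^ 2) / (1 + 2 * s)) ^ 2 / ((1 - y ^ 2) * (P * P'))) := by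
  rw [show 1 - y ^ 2 = (1 - y) * (1 + y) by ring]
  constructor <;> field_simp <;> rw [hP, hP'] <;> ring

lemma hasDerivAt_scherk_add_sub (h0 : 0 < s) (h1 : s < 1 / 10) (hz : ‖z‖ < 1) :
    HasDerivAt (fun z => scherkLog (arcWeight s) (Real.arcsin s) z +
      I * scherkLog (arcWeight s) (Real.arcsin s) (-I * z)) (scherkDeriv s z) z ∧
    HasDerivAt (fun z => scherkLog (arcWeight s) (Real.arcsin s) z -
      I * scherkLog (arcWeight s) (Real.arcsin s) (-I * z))
      (sqrtDil s z ^ 2 * scherkDeriv s z) z := by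
  have d1 := hasDerivAt_scherkLog_arcsin h0 h1 hz
  have d2 := ((hasDerivAt_scherkLog_arcsin h0 h1 (norm_neg_I_mul hz)).comp z
    ((hasDerivAt_id z).const_mul (-I))).const_mul I
  have e : (-I * z) ^ 2 = -z ^ 2 := by rw [mul_pow, neg_sq, I_sq]; ring
  have n0 := jumpPoly_ne_zero h0 h1 hz
  have n1 := one_add_sq_ne_zero hz
  have n2 := one_add_sq_ne_zero (norm_neg_I_mul hz)
  have n3 := one_sub_dilParam_mul_ne_zero h0 h1 hz
  have n4 : (1 + s : ℂ) ≠ 0 := by exact_mod_cast (by linarith : 1 + s ≠ 0)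
  have n5 : (1 + 2 * s : ℂ) ≠ 0 := by exact_mod_cast (by linarith : 1 + 2 * s ≠ 0)
  rw [e] at d2 n2
  have n6 := left_ne_zero_of_mul (right_ne_zero_of_mul n0)
  have n7 := right_ne_zero_of_mul (right_ne_zero_of_mul n0)
  have hβ : (dilParam s : ℂ) = (1 - 2 * s - 4 * s ^ 2) / (1 + 2 * s) := by simp [dilParam]
  have ha : (arcWeight s : ℂ) = 2 * (1 - 2 * s ^ 2) / (1 + s) := by simp [arcWeight]
  have hμ : (derivParam s : ℂ) = (1 - s) * (1 + 2 * s) ^ 2 / (1 + s) := by simp [derivParam]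
  have hq : sqrtDil s z ^ 2 * scherkDeriv s z
      = -(8 * derivParam s * z ^ 2 * (z ^ 4 - dilParam s) ^ 2 / jumpPoly s z) := by
    rw [sqrtDil, scherkDeriv, div_pow, div_mul_div_comm, ← neg_div,
      div_eq_div_iff (mul_ne_zero (pow_ne_zero 2 n3) n0) n0]
    linear_combination (z ^ 2 * (z ^ 4 - dilParam s) ^ 2 * 8 * derivParam s *
      (1 - dilParam s * z ^ 4) ^ 2 * jumpPoly s z) * I_sq
  have hmul : ∀ x : ℂ, I * (x * (-I * 1)) = x := fun x => by linear_combination -x * I_sq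
  have n8 : 1 - z ^ 2 ≠ 0 := by rwa [sub_eq_add_neg]
  rw [show (1 + -z ^ 2) ^ 2 - 4 * (1 - (s : ℂ) ^ 2) * (-z ^ 2)
    = (1 - z ^ 2) ^ 2 + 4 * (1 - s ^ 2) * z ^ 2 by ring, hmul, ← sub_eq_add_neg] at d2
  obtain ⟨k1, k2⟩ := jump_identities n4 n5 n1 n8 n6 n7 rfl rfl
  rw [← hβ, ← ha, ← hμ, show (z ^ 2) ^ 2 = z ^ 4 by ring] at k1 k2
  constructor
  · convert! d1.add d2 using 1
    exact k1.symm
  · rw [hq]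
    convert! d1.sub d2 using 1
    exact k2.symm

lemma norm_sqrtDil_lt (h0 : 0 < s) (h1 : s < 1 / 10) (hz : ‖z‖ < 1) : ‖sqrtDil s z‖ < 1 := by
  obtain ⟨hb0, hb1⟩ := dilParam_mem_Ioo h0 h1
  have hd := norm_pos_iff.2 (one_sub_dilParam_mul_ne_zero h0 h1 hz)
  have hle : ‖z ^ 4 - dilParam s‖ ≤ ‖1 - dilParam s * z ^ 4‖ := by
    have ht : ‖z ^ 4‖ ≤ 1 := by rw [norm_pow]; exact pow_le_one₀ (norm_nonneg z) hz.le
    refine le_of_sq_le_sq ?_ (norm_nonneg _)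
    have ht2 := pow_le_one₀ (n := 2) (norm_nonneg _) ht
    generalize z ^ 4 = t at *
    rw [← normSq_eq_norm_sq, normSq_apply] at ht2 ⊢
    rw [← normSq_eq_norm_sq, normSq_apply]
    simp
    nlinarith [mul_nonneg (by nlinarith : 0 ≤ 1 - dilParam s ^ 2) (sub_nonneg.2 ht2)]
  rw [sqrtDil, norm_div, div_lt_one hd, norm_mul, norm_mul, norm_I, one_mul]
  calc ‖z‖ * ‖z ^ 4 - dilParam s‖ ≤ ‖z‖ * ‖1 - dilParam s * z ^ 4‖ := by gcongr
    _ < 1 * ‖1 - dilParam s * z ^ 4‖ := by gcongr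
    _ = _ := one_mul _

lemma differentiableOn_sqrtDil (h0 : 0 < s) (h1 : s < 1 / 10) :
    DifferentiableOn ℂ (sqrtDil s) (ball 0 1) :=
  .div (by fun_prop) (by fun_prop) fun _ hz =>
    one_sub_dilParam_mul_ne_zero h0 h1 (mem_ball_zero_iff.1 hz)

lemma differentiableOn_scherkDeriv (h0 : 0 < s) (h1 : s < 1 / 10) :
    DifferentiableOn ℂ (scherkDeriv s) (ball 0 1) :=
  .div (by fun_prop) (by unfold jumpPoly; fun_prop) fun _ hz =>
    jumpPoly_ne_zero h0 h1 (mem_ball_zero_iff.1 hz)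

lemma derivParam_pos (h0 : 0 < s) (h1 : s < 1 / 10) : 0 < derivParam s :=
  div_pos (mul_pos (by linarith) (by positivity)) (by linarith)

lemma one_le_arcWeight (h0 : 0 < s) (h1 : s < 1 / 10) : 1 ≤ arcWeight s := by
  rw [arcWeight, le_div_iff₀ (by linarith)]
  nlinarith

lemma arcsin_lt_pi_div_four (h1 : s < 1 / 10) : Real.arcsin s < π / 4 := by
  rw [Real.arcsin_lt_iff_lt_sin' ⟨by linarith [Real.pi_pos], by linarith [Real.pi_pos]⟩,
    Real.sin_pi_div_four]
  nlinarith [Real.sq_sqrt (show (0 : ℝ) ≤ 2 by norm_num), Real.sqrt_nonneg 2]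

lemma hasDerivAt_sqrtDil_zero (s : ℝ) : HasDerivAt (sqrtDil s) (-I * dilParam s) 0 := by
  have h1 : HasDerivAt (fun z : ℂ => I * z * (z ^ 4 - dilParam s)) (-I * dilParam s) 0 := by
    convert! ((hasDerivAt_id (0 : ℂ)).const_mul I).mul
      ((hasDerivAt_pow 4 (0 : ℂ)).sub_const (dilParam s : ℂ)) using 1
    simp
  have h2 : HasDerivAt (fun z : ℂ => 1 - dilParam s * z ^ 4) 0 0 := by
    convert! ((hasDerivAt_pow 4 (0 : ℂ)).const_mul (dilParam s : ℂ)).const_sub 1 using 1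
    simp
  convert! h1.div h2 (by simp) using 1
  simp

lemma scherkLog_zero (a δ : ℝ) : scherkLog a δ 0 = 0 := by
  simp [scherkLog, arcLog]

/-- The scaling that makes the harmonic map cover the unit disk. -/
noncomputable def scherkScale : ℝ := 1 / (2 * √2 * π)

lemma scherkScale_pos : 0 < scherkScale := by
  have := Real.pi_pos
  unfold scherkScale
  positivity

lemma scherkScale_sq : scherkScale ^ 2 = 1 / (8 * π ^ 2) := by
  rw [scherkScale, div_pow, mul_pow, mul_pow, Real.sq_sqrt zero_le_two]
  norm_num

lemma exists_isWeierstrassData (h0 : 0 < s) (h1 : s < 1 / 10) :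
    ∃ k, IsWeierstrassData
      (fun z => scherkScale * (scherkLog (arcWeight s) (Real.arcsin s) z +
        I * scherkLog (arcWeight s) (Real.arcsin s) (-I * z)))
      (fun z => scherkScale * (scherkLog (arcWeight s) (Real.arcsin s) z -
        I * scherkLog (arcWeight s) (Real.arcsin s) (-I * z)))
      k (fun z => scherkScale * scherkDeriv s z) (sqrtDil s) := by
  obtain ⟨k, hk⟩ := (((differentiableOn_sqrtDil h0 h1).const_mul I).mul
    ((differentiableOn_scherkDeriv h0 h1).const_mul (scherkScale : ℂ))).isExactOn_ball
  refine ⟨k, fun z hz => ?_, fun z hz => ?_, hk, fun z hz => ?_, differentiableOn_sqrtDil h0 h1,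
    fun z hz => norm_sqrtDil_lt h0 h1 (mem_ball_zero_iff.1 hz)⟩
  · exact (hasDerivAt_scherk_add_sub h0 h1 (mem_ball_zero_iff.1 hz)).1.const_mul _
  · convert! (hasDerivAt_scherk_add_sub h0 h1 (mem_ball_zero_iff.1 hz)).2.const_mul _ using 1
    ring
  · have hz' := mem_ball_zero_iff.1 hz
    refine mul_ne_zero (ofReal_ne_zero.2 scherkScale_pos.ne') (div_ne_zero (mul_ne_zero
      (mul_ne_zero (by norm_num) (ofReal_ne_zero.2 (derivParam_pos h0 h1).ne'))
      (pow_ne_zero 2 (one_sub_dilParam_mul_ne_zero h0 h1 hz'))) (jumpPoly_ne_zero h0 h1 hz'))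

lemma norm_sq_scherk (a δ : ℝ) (z : ℂ) :
    ‖scherkScale * (scherkLog a δ z + I * scherkLog a δ (-I * z)) +
      conj (scherkScale * (scherkLog a δ z - I * scherkLog a δ (-I * z)))‖ ^ 2
    = ((scherkLog a δ z).re ^ 2 + (scherkLog a δ (I * z)).re ^ 2) / (2 * π ^ 2) := by
  have h : scherkScale * (scherkLog a δ z + I * scherkLog a δ (-I * z)) +
      conj (scherkScale * (scherkLog a δ z - I * scherkLog a δ (-I * z)))
      = (2 * scherkScale : ℝ) * ((scherkLog a δ z).re + (-(scherkLog a δ (I * z)).re : ℝ) * I) := by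
    rw [neg_mul, scherkLog_neg]
    apply Complex.ext <;> simp <;> ring
  rw [h, norm_mul, mul_pow, ← normSq_eq_norm_sq, ← normSq_eq_norm_sq, normSq_ofReal,
    normSq_add_mul_I]
  have := scherkScale_sq
  linear_combination 4 * ((scherkLog a δ z).re ^ 2 + (scherkLog a δ (I * z)).re ^ 2) * this

lemma exists_minimal_graph_curvature_eq (h0 : 0 < s) (h1 : s < 1 / 10) :
    ∃ f : ℝ × ℝ → ℝ, IsMinimalGraph f ∧ pu f (0, 0) = 0 ∧ pv f (0, 0) = 0 ∧
      pu (pu f) (0, 0) * pv (pv f) (0, 0) - pv (pu f) (0, 0) ^ 2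
        = -(π ^ 2 / 2 * (dilParam s / derivParam s) ^ 2) := by
  obtain ⟨k, W⟩ := exists_isWeierstrassData h0 h1
  obtain ⟨S, hSc, hSm, hFS, hS0⟩ := W.exists_section (by simp [scherkLog_zero]) fun ζ hζ r hr => by
    have hr2 : 2 * π ^ 2 * (max r 0) ^ 2 < 2 * π ^ 2 := by
      have : (max r 0) ^ 2 < 1 := pow_lt_one₀ (le_max_right _ _) (max_lt hr one_pos) two_ne_zero
      nlinarith [sq_pos_of_pos Real.pi_pos]
    filter_upwards [avoidsDisk (one_le_arcWeight h0 h1) (Real.arcsin_pos.2 h0)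
      (arcsin_lt_pi_div_four h1) hζ _ hr2] with z hz
    refine (le_max_left r 0).trans_lt (lt_of_pow_lt_pow_left₀ 2 (norm_nonneg _) ?_)
    rw [norm_sq_scherk, lt_div_iff₀ (by positivity)]
    linarith
  refine ⟨heightGraph k S, W.isMinimalGraph_heightGraph hSc hSm hFS, ?_⟩
  have hS : S (((0 : ℝ) : ℂ) + ((0 : ℝ) : ℂ) * I) = 0 := by simp [hS0]
  obtain ⟨e1, e2, e3⟩ := W.curvature_heightGraph hSc hSm hFS (p := (0, 0)) (by simp [unitDisk])
    (by rw [hS]; simp [sqrtDil])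
  refine ⟨e1, e2, ?_⟩
  rw [e3, hS, (hasDerivAt_sqrtDil_zero s).deriv]
  have := scherkScale_sq
  simp [scherkDeriv, jumpPoly, div_pow, mul_pow, this]
  field_simp
  ring

lemma eventually_lt_curvature {c : ℝ} (hc : c < π ^ 2 / 2) :
    ∃ s : ℝ, 0 < s ∧ s < 1 / 10 ∧ c < π ^ 2 / 2 * (dilParam s / derivParam s) ^ 2 := by
  have hcont : ContinuousAt (fun s => π ^ 2 / 2 * (dilParam s / derivParam s) ^ 2) 0 := by
    unfold dilParam derivParam
    refine continuousAt_const.mul (((ContinuousAt.div ?_ ?_ ?_).div (ContinuousAt.div ?_ ?_ ?_) ?_).pow 2)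
    any_goals fun_prop
    all_goals norm_num
  have h1 := hcont.eventually_const_lt (u := c) (by simpa [dilParam, derivParam] using hc)
  have h2 : ∀ᶠ s : ℝ in 𝓝[>] 0, s < 1 / 10 :=
    (eventually_lt_nhds (by norm_num)).filter_mono nhdsWithin_le_nhds
  obtain ⟨s, ⟨hs1, hs2⟩, hs3⟩ :=
    (((h1.filter_mono nhdsWithin_le_nhds).and h2).and self_mem_nhdsWithin).exists
  exact ⟨s, hs3, hs2, hs1⟩

end data

end

/-- Finn–Osserman. For every `c < π²/2` there is a minimal graph
over the unit disk whose gradient vanishes at the origin and whose Gaussian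
curvature at the origin satisfies `|K| > c`. -/
theorem exists_minimal_graph_large_curvature (c : ℝ) (hc : c < π ^ 2 / 2) :
    ∃ f : ℝ × ℝ → ℝ, IsMinimalGraph f ∧
      pu f ((0 : ℝ), (0 : ℝ)) = 0 ∧ pv f ((0 : ℝ), (0 : ℝ)) = 0 ∧
      |pu (pu f) ((0 : ℝ), (0 : ℝ)) * pv (pv f) ((0 : ℝ), (0 : ℝ))
          - (pv (pu f) ((0 : ℝ), (0 : ℝ))) ^ 2|
        / (1 + (pu f ((0 : ℝ), (0 : ℝ))) ^ 2 + (pv f ((0 : ℝ), (0 : ℝ))) ^ 2) ^ 2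
      > c := by
  obtain ⟨s, h0, h1, hs⟩ := eventually_lt_curvature hc
  obtain ⟨f, hf, hu, hv, hK⟩ := exists_minimal_graph_curvature_eq h0 h1
  refine ⟨f, hf, hu, hv, ?_⟩
  rw [hK, hu, hv, abs_neg, abs_of_nonneg (by positivity)]
  simpa using hs
end

section
/- Consider the functions f₁(x) = (π²/2)·(1+x)²/(1−x)² and f₂(x) = (16π²/27)·(1+x²)/(1+x)² on the interval [0,1). Then sup_{0 ≤ x < 1} min(f₁(x), f₂(x)) = (2π²/27)(2 + √31); moreover the supremum is attained, namely there exists x₀ ∈ (0,1) with f₁(x₀) = f₂(x₀) = (2π²/27)(2 + √31). -/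
open Real Set

/-- The first function in terms of `((1 - x) / (1 + x)) ^ 2`. -/
lemma first_eq_div_sq (x : ℝ) :
    π ^ 2 / 2 * (1 + x) ^ 2 / (1 - x) ^ 2 = π ^ 2 / 2 / ((1 - x) / (1 + x)) ^ 2 := by
  rw [div_pow, div_div_eq_mul_div]

/-- The second function in terms of `((1 - x) / (1 + x)) ^ 2`. -/
lemma second_eq_one_add_sq {x : ℝ} (hx : 1 + x ≠ 0) :
    16 * π ^ 2 / 27 * (1 + x ^ 2) / (1 + x) ^ 2 =
      8 * π ^ 2 / 27 * (1 + ((1 - x) / (1 + x)) ^ 2) := by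
  field_simp
  ring

/-- The value of `((1 - x) / (1 + x)) ^ 2` at which the two functions agree. -/
lemma first_at_crossing :
    π ^ 2 / 2 / ((√31 - 2) / 4) = 2 * π ^ 2 / 27 * (2 + √31) := by
  have hs : √31 ^ 2 = (31 : ℝ) := Real.sq_sqrt (by norm_num)
  have h2 : (2 : ℝ) < √31 := Real.lt_sqrt_of_sq_lt (by norm_num)
  rw [div_eq_iff (by linarith)]
  linear_combination (-(π ^ 2) / 54) * hs

lemma second_at_crossing :
    8 * π ^ 2 / 27 * (1 + (√31 - 2) / 4) = 2 * π ^ 2 / 27 * (2 + √31) := by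
  ring

/-- With `f₁(x) = (π²/2)(1+x)²/(1−x)²` and
`f₂(x) = (16π²/27)(1+x²)/(1+x)²` on `[0,1)`, the supremum of `min(f₁, f₂)` equals
`(2π²/27)(2+√31)`, it is attained, and at the maximizing point `x₀ ∈ (0,1)` one has
`f₁(x₀) = f₂(x₀) = (2π²/27)(2+√31)`. -/
theorem sup_min_eq :
    IsGreatest
      ((fun x : ℝ => min (π ^ 2 / 2 * (1 + x) ^ 2 / (1 - x) ^ 2)
          (16 * π ^ 2 / 27 * (1 + x ^ 2) / (1 + x) ^ 2)) '' Set.Ico (0 : ℝ) 1)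
      (2 * π ^ 2 / 27 * (2 + Real.sqrt 31)) ∧
    ∃ x₀ ∈ Set.Ioo (0 : ℝ) 1,
      π ^ 2 / 2 * (1 + x₀) ^ 2 / (1 - x₀) ^ 2 = 2 * π ^ 2 / 27 * (2 + Real.sqrt 31) ∧
      16 * π ^ 2 / 27 * (1 + x₀ ^ 2) / (1 + x₀) ^ 2
        = 2 * π ^ 2 / 27 * (2 + Real.sqrt 31) := by
  have h2 : (2 : ℝ) < √31 := Real.lt_sqrt_of_sq_lt (by norm_num)
  have h6 : √31 < (6 : ℝ) := (Real.sqrt_lt' (by norm_num)).2 (by norm_num)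
  have crossing : ∃ x₀ ∈ Set.Ioo (0 : ℝ) 1,
      π ^ 2 / 2 * (1 + x₀) ^ 2 / (1 - x₀) ^ 2 = 2 * π ^ 2 / 27 * (2 + √31) ∧
      16 * π ^ 2 / 27 * (1 + x₀ ^ 2) / (1 + x₀) ^ 2 = 2 * π ^ 2 / 27 * (2 + √31) := by
    obtain ⟨r, hr0, hr1, hr⟩ : ∃ r : ℝ, 0 < r ∧ r < 1 ∧ r ^ 2 = (√31 - 2) / 4 :=
      ⟨√((√31 - 2) / 4), Real.sqrt_pos.2 (by linarith),
        (Real.sqrt_lt' one_pos).2 (by linarith), Real.sq_sqrt (by linarith)⟩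
    have hx0 : 0 < (1 - r) / (1 + r) := div_pos (by linarith) (by linarith)
    have hx1 : (1 - r) / (1 + r) < 1 := (div_lt_one (by linarith)).2 (by linarith)
    have hcayley : (1 - (1 - r) / (1 + r)) / (1 + (1 - r) / (1 + r)) = r := by
      rw [div_eq_iff (by linarith)]
      field_simp
      ring
    refine ⟨(1 - r) / (1 + r), ⟨hx0, hx1⟩, ?_, ?_⟩
    · rw [first_eq_div_sq, hcayley, hr, first_at_crossing]
    · rw [second_eq_one_add_sq (by linarith), hcayley, hr, second_at_crossing]
  refine ⟨⟨?_, ?_⟩, crossing⟩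
  · obtain ⟨x, hx, hfirst, hsecond⟩ := crossing
    exact ⟨x, Set.Ioo_subset_Ico_self hx, by simp only [hfirst, hsecond, min_self]⟩
  · rintro _ ⟨x, ⟨hx0, hx1⟩, rfl⟩
    simp only
    rw [first_eq_div_sq, second_eq_one_add_sq (by linarith)]
    rcases le_total (((1 - x) / (1 + x)) ^ 2) ((√31 - 2) / 4) with h | h
    · rw [← second_at_crossing]
      exact (min_le_right _ _).trans (by gcongr)
    · rw [← first_at_crossing]
      have : 0 < (√31 - 2) / 4 := by linarith
      exact (min_le_left _ _).trans (by gcongr)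
end
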